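/- arXiv:0912.2190 — 4 statements merged into one kernel-verified Lean document; each statement's English description precedes it below -/
import Mathlib

section
/- (Schulze) Let v be a valued relation on a finite set A and let v* be its indirect scores. Then the indirect comparison relation ν = {(x,y) : x ≠ y and v*_{xy} > v*_{yx}} is a partial order, i.e. it is asymmetric and transitive. -/
/-! Common definitions: valued relations, indirect scores, admissible orders,
projected margins/scores, rank-like rates (Camps–Mora–Saumell CLC method). -/

variable {A : Type*} [Fintype A] [DecidableEq A]

/-- The score of a chain `x₀ :: x₁ :: ... :: xₙ`: the minimum of `v xᵢ xᵢ₊₁`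
over its links (value `1` for chains with no link, which we never use). -/
noncomputable def linkScore (v : A → A → ℝ) : List A → ℝ
  | [] => 1
  | [_] => 1
  | [a, b] => v a b
  | a :: b :: c :: l => min (v a b) (linkScore v (b :: c :: l))

/-- The indirect score `v*_{xy}`: the supremum (= maximum) of the scores of all
paths from `x` to `y` (with at least one link, consecutive elements distinct). -/
noncomputable def istar (v : A → A → ℝ) (x y : A) : ℝ :=
  sSup { s : ℝ | ∃ l : List A, List.Chain' (· ≠ ·) (x :: (l ++ [y])) ∧
      s = linkScore v (x :: (l ++ [y])) }

/-- `ξ` is a strict total order: irreflexive, transitive, total. -/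
def StrictTotal (ξ : A → A → Prop) : Prop :=
  (∀ x, ¬ ξ x x) ∧ (∀ x y z, ξ x y → ξ y z → ξ x z) ∧ (∀ x y, x ≠ y → ξ x y ∨ ξ y x)

/-- `ξ` is admissible for `v`: `v*_{xy} > v*_{yx}` implies `x` precedes `y`. -/
def Adm (v : A → A → ℝ) (ξ : A → A → Prop) : Prop :=
  ∀ x y, istar v x y > istar v y x → ξ x y

/-- Intermediate projected margin `m^σ_{xy}` (for `x` preceding `y` in `ξ`):
the infimum (= minimum) of the indirect margins `m*_{pq}` over `p ⪯ x`, `y ⪯ q`. -/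
noncomputable def msigma (v : A → A → ℝ) (ξ : A → A → Prop) (x y : A) : ℝ :=
  sInf { s : ℝ | ∃ p q, (ξ p x ∨ p = x) ∧ (ξ y q ∨ q = y) ∧
      s = istar v p q - istar v q p }

/-- `q` is the immediate successor of `p` in `ξ`. -/
def ImmSucc (ξ : A → A → Prop) (p q : A) : Prop :=
  ξ p q ∧ ∀ z, ¬ (ξ p z ∧ ξ z q)

/-- Projected margin (for `x` preceding `y` in `ξ`): the supremum (= maximum) of
`m^σ_{p p'}` over `x ⪯ p ≺ y`, `p'` the immediate successor of `p`. -/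
noncomputable def mpiAux (v : A → A → ℝ) (ξ : A → A → Prop) (x y : A) : ℝ :=
  sSup { s : ℝ | ∃ p q, (ξ x p ∨ p = x) ∧ ξ p y ∧ ImmSucc ξ p q ∧
      s = msigma v ξ p q }

open Classical in
/-- Projected margins `m^π`, extended antisymmetrically. -/
noncomputable def mpi (v : A → A → ℝ) (ξ : A → A → Prop) (x y : A) : ℝ :=
  if ξ x y then mpiAux v ξ x y else - mpiAux v ξ y x

/-- Projected scores `v^π_{xy} = (1 + m^π_{xy})/2`. -/
noncomputable def vpi (v : A → A → ℝ) (ξ : A → A → Prop) (x y : A) : ℝ :=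
  (1 + mpi v ξ x y) / 2

/-- Rank-like rate `R_x = N - ∑_{y ≠ x} v^π_{xy}`. -/
noncomputable def rlr (v : A → A → ℝ) (ξ : A → A → Prop) (x : A) : ℝ :=
  (Fintype.card A : ℝ) - ∑ y ∈ Finset.univ.erase x, vpi v ξ x y

/-- `v` is a complete Llull matrix: scores of distinct pairs lie in `[0,1]`
and satisfy `v_{xy} + v_{yx} = 1`. -/
def Llull (v : A → A → ℝ) : Prop :=
  ∀ x y : A, x ≠ y → 0 ≤ v x y ∧ v x y ≤ 1 ∧ v x y + v y x = 1

/-- The score of a concatenated chain is the minimum of the scores of its two parts. -/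
lemma linkScore_append {B : Type*} (v : B → B → ℝ) (x y z : B) (l m : List B) :
    linkScore v (x :: (l ++ y :: (m ++ [z]))) =
      min (linkScore v (x :: (l ++ [y]))) (linkScore v (y :: (m ++ [z]))) := by
  induction l generalizing x with
  | nil => cases m <;> simp [linkScore]
  | cons a l ih =>
    have key : ∀ k : List B, k ≠ [] →
        linkScore v (x :: a :: k) = min (v x a) (linkScore v (a :: k)) := by
      rintro (_ | ⟨b, k⟩) hk
      · exact absurd rfl hk
      · rfl
    rw [List.cons_append, List.cons_append, key _ (by simp), key _ (by simp), ih, min_assoc]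

lemma linkScore_le_one {B : Type*} {v : B → B → ℝ} (hv : ∀ x y, x ≠ y → v x y ≤ 1)
    (l : List B) (hl : l.IsChain (· ≠ ·)) : linkScore v l ≤ 1 := by
  match l, hl with
  | [], _ => exact le_rfl
  | [_], _ => exact le_rfl
  | [a, b], hl => exact hv a b (by simpa using hl)
  | a :: b :: c :: l, hl =>
    exact (min_le_left _ _).trans (hv a b (List.isChain_cons_cons.1 hl).1)

lemma linkScore_le_istar {B : Type*} {v : B → B → ℝ} (hv : ∀ x y, x ≠ y → v x y ≤ 1)
    {x y : B} {l : List B} (hl : (x :: (l ++ [y])).IsChain (· ≠ ·)) :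
    linkScore v (x :: (l ++ [y])) ≤ istar v x y := by
  refine le_csSup ⟨1, ?_⟩ ⟨l, hl, rfl⟩
  rintro _ ⟨k, hk, rfl⟩
  exact linkScore_le_one hv _ hk

lemma exists_lt_linkScore {B : Type*} {v : B → B → ℝ} {x y : B} (hxy : x ≠ y) {t : ℝ}
    (ht : t < istar v x y) :
    ∃ l : List B, (x :: (l ++ [y])).IsChain (· ≠ ·) ∧ t < linkScore v (x :: (l ++ [y])) := by
  obtain ⟨_, ⟨l, hl, rfl⟩, h⟩ := exists_lt_of_lt_csSup
    (by exact ⟨_, [], List.isChain_pair.2 hxy, rfl⟩) ht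
  exact ⟨l, hl, h⟩

/-- Indirect scores satisfy the max-min triangle inequality. -/
lemma min_istar_le {B : Type*} {v : B → B → ℝ} (hv : ∀ x y, x ≠ y → v x y ≤ 1)
    {x y z : B} (hxy : x ≠ y) (hyz : y ≠ z) :
    min (istar v x y) (istar v y z) ≤ istar v x z := by
  refine le_of_forall_lt fun t ht => ?_
  obtain ⟨l, hl, htl⟩ := exists_lt_linkScore hxy (ht.trans_le (min_le_left _ _))
  obtain ⟨m, hm, htm⟩ := exists_lt_linkScore hyz (ht.trans_le (min_le_right _ _))
  have hc : (x :: ((l ++ y :: m) ++ [z])).IsChain (· ≠ ·) := by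
    rw [List.append_assoc, List.cons_append, ← List.cons_append]
    exact List.isChain_split.2 ⟨hl, hm⟩
  refine lt_of_lt_of_le ?_ (linkScore_le_istar hv hc)
  rw [List.append_assoc, List.cons_append, linkScore_append]
  exact lt_min htl htm

/-- Schulze: The indirect comparison relation
`ν = {(x,y) : x ≠ y, v*_{xy} > v*_{yx}}` is asymmetric and transitive. -/
theorem stmt2 {A : Type*} [Fintype A] [DecidableEq A] (v : A → A → ℝ)
    (hv : ∀ x y : A, x ≠ y → 0 ≤ v x y ∧ v x y ≤ 1) :
    (∀ x y : A, x ≠ y → istar v x y > istar v y x →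
      ¬ (y ≠ x ∧ istar v y x > istar v x y)) ∧
    (∀ x y z : A, x ≠ y → y ≠ z → x ≠ z →
      istar v x y > istar v y x → istar v y z > istar v z y →
      istar v x z > istar v z x) := by
  refine ⟨fun x y _ h h' => lt_asymm h h'.2, fun x y z hxy hyz hxz h₁ h₂ => ?_⟩
  have hv' : ∀ x y, x ≠ y → v x y ≤ 1 := fun x y h => (hv x y h).2
  by_contra! h₃
  have hc := min_istar_le hv' hxy hyz
  have ha := min_istar_le hv' hyz hxz.symm
  have hb := min_istar_le hv' hxz.symm hxy
  grind
end

section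
/- Let v be a complete Llull matrix on a finite set A, let ξ be an admissible order for v, and let m^π be the projected margins computed with respect to ξ. Then: (i) 0 ≤ m^π_{xy} ≤ 1 whenever x precedes y in ξ; and (ii) m^π_{xz} = max(m^π_{xy}, m^π_{yz}) whenever x precedes y and y precedes z in ξ. -/
/-! Common definitions: valued relations, indirect scores, admissible orders,
projected margins/scores, rank-like rates (Camps–Mora–Saumell CLC method). -/

variable {A : Type*} [Fintype A] [DecidableEq A]

theorem linkScore_mem_Icc {A : Type*} {v : A → A → ℝ} (hv : Llull v) :
    ∀ l : List A, List.IsChain (· ≠ ·) l → linkScore v l ∈ Set.Icc (0 : ℝ) 1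
  | [], _ => by simp [linkScore]
  | [_], _ => by simp [linkScore]
  | [a, b], h => by
    have hab : a ≠ b := by simpa using h
    exact ⟨(hv a b hab).1, (hv a b hab).2.1⟩
  | a :: b :: c :: l, h => by
    obtain ⟨hab, hl⟩ := List.isChain_cons_cons.1 h
    have ih := linkScore_mem_Icc hv (b :: c :: l) hl
    exact ⟨le_min (hv a b hab).1 ih.1, (min_le_right _ _).trans ih.2⟩

theorem istar_mem_Icc {A : Type*} {v : A → A → ℝ} (hv : Llull v) (x y : A) :
    istar v x y ∈ Set.Icc (0 : ℝ) 1 := by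
  constructor
  · apply Real.sSup_nonneg
    rintro s ⟨l, hl, rfl⟩
    exact (linkScore_mem_Icc hv _ hl).1
  · refine Real.sSup_le ?_ zero_le_one
    rintro s ⟨l, hl, rfl⟩
    exact (linkScore_mem_Icc hv _ hl).2

theorem istar_le_of_adm {A : Type*} {v : A → A → ℝ} {ξ : A → A → Prop} (hξ : StrictTotal ξ)
    (hadm : Adm v ξ) {p q : A} (hpq : ξ p q) : istar v q p ≤ istar v p q := by
  by_contra! h
  exact hξ.1 p (hξ.2.1 p q p hpq (hadm q p h))

theorem msigma_mem_Icc {A : Type*} {v : A → A → ℝ} (hv : Llull v) {ξ : A → A → Prop}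
    (hξ : StrictTotal ξ) (hadm : Adm v ξ) {x y : A} (hxy : ξ x y) :
    msigma v ξ x y ∈ Set.Icc (0 : ℝ) 1 := by
  have margin_nonneg : ∀ s ∈ { s : ℝ | ∃ p q, (ξ p x ∨ p = x) ∧ (ξ y q ∨ q = y) ∧
      s = istar v p q - istar v q p }, 0 ≤ s := by
    rintro s ⟨p, q, hp, hq, rfl⟩
    have hpy : ξ p y := by
      rcases hp with hp | rfl
      · exact hξ.2.1 _ _ _ hp hxy
      · exact hxy
    have hpq : ξ p q := by
      rcases hq with hq | rfl
      · exact hξ.2.1 _ _ _ hpy hq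
      · exact hpy
    exact sub_nonneg.2 (istar_le_of_adm hξ hadm hpq)
  refine ⟨Real.sInf_nonneg margin_nonneg, ?_⟩
  have hle : msigma v ξ x y ≤ istar v x y - istar v y x :=
    csInf_le ⟨0, margin_nonneg⟩ ⟨x, y, Or.inr rfl, Or.inr rfl, rfl⟩
  linarith [(istar_mem_Icc hv x y).2, (istar_mem_Icc hv y x).1]

theorem mpiAux_mem_Icc {A : Type*} {v : A → A → ℝ} (hv : Llull v) {ξ : A → A → Prop}
    (hξ : StrictTotal ξ) (hadm : Adm v ξ) (x y : A) :
    mpiAux v ξ x y ∈ Set.Icc (0 : ℝ) 1 := by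
  constructor
  · apply Real.sSup_nonneg
    rintro s ⟨p, q, -, -, hpq, rfl⟩
    exact (msigma_mem_Icc hv hξ hadm hpq.1).1
  · refine Real.sSup_le ?_ zero_le_one
    rintro s ⟨p, q, -, -, hpq, rfl⟩
    exact (msigma_mem_Icc hv hξ hadm hpq.1).2

theorem msigma_le_mpiAux {A : Type*} {v : A → A → ℝ} (hv : Llull v) {ξ : A → A → Prop}
    (hξ : StrictTotal ξ) (hadm : Adm v ξ) {x y p q : A} (hxp : ξ x p ∨ p = x) (hpy : ξ p y)
    (hpq : ImmSucc ξ p q) : msigma v ξ p q ≤ mpiAux v ξ x y := by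
  refine le_csSup ⟨1, ?_⟩ ⟨p, q, hxp, hpy, hpq, rfl⟩
  rintro s ⟨p, q, -, -, hpq, rfl⟩
  exact (msigma_mem_Icc hv hξ hadm hpq.1).2

theorem mpiAux_eq_max {A : Type*} {v : A → A → ℝ} (hv : Llull v) {ξ : A → A → Prop}
    (hξ : StrictTotal ξ) (hadm : Adm v ξ) {x y z : A} (hxy : ξ x y) (hyz : ξ y z) :
    mpiAux v ξ x z = max (mpiAux v ξ x y) (mpiAux v ξ y z) := by
  have hnonneg := (mpiAux_mem_Icc hv hξ hadm x z).1
  apply le_antisymm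
  · refine Real.sSup_le ?_ (le_max_of_le_left (mpiAux_mem_Icc hv hξ hadm x y).1)
    rintro s ⟨p, q, hxp, hpz, hpq, rfl⟩
    by_cases hpy : ξ p y
    · exact le_max_of_le_left (msigma_le_mpiAux hv hξ hadm hxp hpy hpq)
    · have hyp : ξ y p ∨ p = y := by
        by_cases h : p = y
        · exact Or.inr h
        · exact Or.inl ((hξ.2.2 p y h).resolve_left hpy)
      exact le_max_of_le_right (msigma_le_mpiAux hv hξ hadm hyp hpz hpq)
  · refine max_le (Real.sSup_le ?_ hnonneg) (Real.sSup_le ?_ hnonneg)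
    · rintro s ⟨p, q, hxp, hpy, hpq, rfl⟩
      exact msigma_le_mpiAux hv hξ hadm hxp (hξ.2.1 _ _ _ hpy hyz) hpq
    · rintro s ⟨p, q, hyp, hpz, hpq, rfl⟩
      refine msigma_le_mpiAux hv hξ hadm (Or.inl ?_) hpz hpq
      rcases hyp with hyp | rfl
      · exact hξ.2.1 _ _ _ hxy hyp
      · exact hxy

/-- For a complete Llull matrix and an admissible order `ξ`, the
projected margins satisfy `0 ≤ m^π_{xy} ≤ 1` whenever `x ≺ y`, and
`m^π_{xz} = max (m^π_{xy}, m^π_{yz})` whenever `x ≺ y ≺ z`. -/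
theorem stmt4 {A : Type*} [Fintype A] [DecidableEq A] (v : A → A → ℝ)
    (hv : Llull v) (ξ : A → A → Prop) (hξ : StrictTotal ξ) (hadm : Adm v ξ) :
    (∀ x y, ξ x y → 0 ≤ mpi v ξ x y ∧ mpi v ξ x y ≤ 1) ∧
    (∀ x y z, ξ x y → ξ y z →
      mpi v ξ x z = max (mpi v ξ x y) (mpi v ξ y z)) := by
  constructor
  · intro x y hxy
    rw [mpi, if_pos hxy]
    exact mpiAux_mem_Icc hv hξ hadm x y
  · intro x y z hxy hyz
    rw [mpi, mpi, mpi, if_pos (hξ.2.1 _ _ _ hxy hyz), if_pos hxy, if_pos hyz]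
    exact mpiAux_eq_max hv hξ hadm hxy hyz
end

section
/- Let v be a complete Llull matrix on a finite set A. The projected scores do not depend on the admissible order ξ used for their calculation: for any two admissible orders ξ and ξ̃, the projected score v^π_{xy} computed via ξ equals the one computed via ξ̃, for every ordered pair (x,y) of distinct elements. Moreover, if x_i denotes the element of rank i in ξ and x̃_i the element of rank i in ξ̃, then the projected score of the pair (x_i, x_j) computed via ξ equals the projected score of the pair (x̃_i, x̃_j) computed via ξ̃, for every pair of distinct indices i, j. -/
/-! Common definitions: valued relations, indirect scores, admissible orders,
projected margins/scores, rank-like rates (Camps–Mora–Saumell CLC method). -/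

variable {A : Type*} [Fintype A] [DecidableEq A]

section

variable {B : Type*} {v : B → B → ℝ} {ξ ξ' : B → B → Prop} {p q x y x' y' : B}

lemma StrictTotal.flip (hξ : StrictTotal ξ) : StrictTotal (fun a b => ξ b a) :=
  ⟨hξ.1, fun _ _ _ h h' => hξ.2.1 _ _ _ h' h, fun x y h => hξ.2.2 y x h.symm⟩

/-- An immediate successor bounds from below everything that lies outside the lower section. -/
lemma ImmSucc.le_iff (hξ : StrictTotal ξ) (h : ImmSucc ξ p q) (z : B) :
    (ξ q z ∨ z = q) ↔ ¬ (ξ z p ∨ z = p) := by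
  obtain ⟨hirr, htrans, htot⟩ := hξ
  constructor
  · rintro (hz | rfl) (hz' | rfl)
    · exact hirr _ (htrans _ _ _ h.1 (htrans _ _ _ hz hz'))
    · exact hirr _ (htrans _ _ _ h.1 hz)
    · exact hirr _ (htrans _ _ _ h.1 hz')
    · exact hirr _ h.1
  · intro hz
    push Not at hz
    by_cases hzq : z = q
    · exact Or.inr hzq
    · have hpz : ξ p z := (htot z p hz.2).resolve_left hz.1
      exact Or.inl ((htot z q hzq).resolve_left fun hzq' => h.2 z ⟨hpz, hzq'⟩)

lemma indirectMargin_nonneg (hξ : StrictTotal ξ) (hadm : Adm v ξ) (hxy : ξ x y) :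
    0 ≤ istar v x y - istar v y x := by
  by_contra! h
  exact hξ.1 _ (hξ.2.1 _ _ _ hxy (hadm y x (by linarith)))

lemma msigma_nonneg (hξ : StrictTotal ξ) (hadm : Adm v ξ) (hxy : ξ x y) :
    0 ≤ msigma v ξ x y := by
  apply Real.sInf_nonneg
  rintro _ ⟨a, b, ha, hb, rfl⟩
  have hay : ξ a y := ha.elim (fun h => hξ.2.1 _ _ _ h hxy) (fun h => h ▸ hxy)
  exact indirectMargin_nonneg hξ hadm
    (hb.elim (fun h => hξ.2.1 _ _ _ hay h) (fun h => h ▸ hay))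

lemma mpiAux_nonneg (hξ : StrictTotal ξ) (hadm : Adm v ξ) :
    0 ≤ mpiAux v ξ x y := by
  apply Real.sSup_nonneg
  rintro _ ⟨a, b, -, -, hab, rfl⟩
  exact msigma_nonneg hξ hadm hab.1

variable [Finite B]

lemma msigma_le (hp : ξ p x ∨ p = x) (hq : ξ y q ∨ q = y) :
    msigma v ξ x y ≤ istar v p q - istar v q p := by
  refine csInf_le (Set.Finite.bddBelow ?_) ⟨p, q, hp, hq, rfl⟩
  refine (Set.finite_range fun z : B × B => istar v z.1 z.2 - istar v z.2 z.1).subset ?_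
  rintro _ ⟨a, b, -, -, rfl⟩
  exact ⟨(a, b), rfl⟩

lemma msigma_le_mpiAux_s5 (hp : ξ x p ∨ p = x) (hpy : ξ p y) (h : ImmSucc ξ p q) :
    msigma v ξ p q ≤ mpiAux v ξ x y := by
  refine le_csSup (Set.Finite.bddAbove ?_) ⟨p, q, hp, hpy, h, rfl⟩
  refine (Set.finite_range fun z : B × B => msigma v ξ z.1 z.2).subset ?_
  rintro _ ⟨a, b, -, -, -, rfl⟩
  exact ⟨(a, b), rfl⟩

lemma StrictTotal.exists_min (hξ : StrictTotal ξ) {s : Set B} (hs : s.Nonempty) :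
    ∃ m ∈ s, ∀ z ∈ s, ¬ ξ z m := by
  have : Std.Irrefl ξ := ⟨hξ.1⟩
  have : IsTrans B ξ := ⟨hξ.2.1⟩
  exact (Finite.wellFounded_of_trans_of_irrefl ξ).has_min s hs

/-- A cut of one admissible order with positive intermediate projected margin is a cut, with the
same margin, of any other admissible order. -/
lemma exists_immSucc_msigma_eq (hξ : StrictTotal ξ) (hξ' : StrictTotal ξ') (hadm' : Adm v ξ')
    (h : ImmSucc ξ p q) (hpos : 0 < msigma v ξ p q) :
    ∃ p' q', ImmSucc ξ' p' q' ∧ (∀ z, (ξ' z p' ∨ z = p') ↔ (ξ z p ∨ z = p)) ∧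
      msigma v ξ' p' q' = msigma v ξ p q := by
  have hq := h.le_iff hξ
  have hcut : ∀ z w, (ξ z p ∨ z = p) → ¬ (ξ w p ∨ w = p) → ξ' z w := fun z w hz hw =>
    hadm' z w (by linarith [msigma_le (v := v) hz ((hq w).2 hw)])
  obtain ⟨p', hp', hmax⟩ := hξ'.flip.exists_min (s := {z | ξ z p ∨ z = p}) ⟨p, Or.inr rfl⟩
  obtain ⟨q', hq', hmin⟩ := hξ'.exists_min (s := {z | ¬ (ξ z p ∨ z = p)})
    ⟨q, (hq q).1 (Or.inr rfl)⟩
  have hsucc : ImmSucc ξ' p' q' := by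
    refine ⟨hcut _ _ hp' hq', fun z hz => ?_⟩
    by_cases hzp : ξ z p ∨ z = p
    · exact hmax z hzp hz.1
    · exact hmin z hzp hz.2
  have hlow : ∀ z, (ξ' z p' ∨ z = p') ↔ (ξ z p ∨ z = p) := by
    refine fun z => ⟨fun hz => ?_, fun hz => ?_⟩
    · by_contra hzp
      have hpz := hcut _ _ hp' hzp
      rcases hz with hz | rfl
      · exact hξ'.1 _ (hξ'.2.1 _ _ _ hz hpz)
      · exact hzp hp'
    · by_cases hzp : z = p'
      · exact Or.inr hzp
      · exact Or.inl ((hξ'.2.2 _ _ hzp).resolve_right (hmax z hz))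
  refine ⟨p', q', hsucc, hlow, ?_⟩
  simp only [msigma, hsucc.le_iff hξ', hlow, hq]

lemma mpiAux_le_mpiAux (hξ : StrictTotal ξ) (hξ' : StrictTotal ξ') (hadm' : Adm v ξ')
    (hsep : ∀ p p', (∀ z, (ξ' z p' ∨ z = p') ↔ (ξ z p ∨ z = p)) → (ξ x p ∨ p = x) → ξ p y →
      (ξ' x' p' ∨ p' = x') ∧ ξ' p' y') :
    mpiAux v ξ x y ≤ mpiAux v ξ' x' y' := by
  refine Real.sSup_le ?_ (mpiAux_nonneg hξ' hadm')
  rintro _ ⟨p, q, hxp, hpy, hpq, rfl⟩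
  rcases le_or_gt (msigma v ξ p q) 0 with hle | hpos
  · exact hle.trans (mpiAux_nonneg hξ' hadm')
  · obtain ⟨p', q', hpq', hlow, heq⟩ := exists_immSucc_msigma_eq hξ hξ' hadm' hpq hpos
    obtain ⟨hx, hy⟩ := hsep p p' hlow hxp hpy
    exact heq ▸ msigma_le_mpiAux_s5 hx hy hpq'

lemma mpiAux_le_of_adm (hξ : StrictTotal ξ) (hξ' : StrictTotal ξ') (hadm' : Adm v ξ') :
    mpiAux v ξ x y ≤ mpiAux v ξ' x y := by
  refine mpiAux_le_mpiAux hξ hξ' hadm' fun p p' hlow hxp hpy => ?_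
  have hx := (hlow x).2 (hxp.imp_right Eq.symm)
  have hy : ¬ (ξ' y p' ∨ y = p') := by
    rw [hlow]
    rintro (h | rfl)
    · exact hξ.1 _ (hξ.2.1 _ _ _ h hpy)
    · exact hξ.1 _ hpy
  push Not at hy
  exact ⟨hx.imp_right Eq.symm, (hξ'.2.2 _ _ hy.2).resolve_left hy.1⟩

lemma mpiAux_eq_zero (hξ : StrictTotal ξ) (hadm : Adm v ξ) (hξ' : StrictTotal ξ')
    (hadm' : Adm v ξ') (hyx : ξ' y x) : mpiAux v ξ x y = 0 := by
  refine le_antisymm (Real.sSup_le ?_ le_rfl) (mpiAux_nonneg hξ hadm)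
  rintro _ ⟨p, q, hxp, hpy, hpq, rfl⟩
  have hy : ξ q y ∨ y = q := (hpq.le_iff hξ y).2 <| by
    rintro (h | rfl)
    · exact hξ.1 _ (hξ.2.1 _ _ _ h hpy)
    · exact hξ.1 _ hpy
  linarith [msigma_le (v := v) (hxp.imp_right Eq.symm) hy, indirectMargin_nonneg hξ' hadm' hyx]

/-- Independence of the projected margins from the admissible order. -/
lemma mpi_eq_mpi (hξ : StrictTotal ξ) (hadm : Adm v ξ) (hξ' : StrictTotal ξ')
    (hadm' : Adm v ξ') (hxy : x ≠ y) : mpi v ξ x y = mpi v ξ' x y := by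
  have hagree (a b : B) : mpiAux v ξ a b = mpiAux v ξ' a b :=
    le_antisymm (mpiAux_le_of_adm hξ hξ' hadm') (mpiAux_le_of_adm hξ' hξ hadm)
  unfold mpi
  split_ifs with h h' h'
  · exact hagree x y
  · have hyx := (hξ'.2.2 x y hxy).resolve_left h'
    rw [← hagree, mpiAux_eq_zero hξ hadm hξ' hadm' hyx, hagree,
      mpiAux_eq_zero hξ' hadm' hξ hadm h, neg_zero]
  · have hyx := (hξ.2.2 x y hxy).resolve_left h
    rw [mpiAux_eq_zero hξ hadm hξ' hadm' h', mpiAux_eq_zero hξ' hadm' hξ hadm hyx, neg_zero]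
  · rw [hagree]

end

section

variable {B : Type*} {v : B → B → ℝ} {ξ ξ' : B → B → Prop} {n : ℕ} {e e' : Fin n ≃ B}

lemma StrictTotal.rel_iff_lt (hξ : StrictTotal ξ) (he : ∀ i j, i < j → ξ (e i) (e j))
    (i j : Fin n) : ξ (e i) (e j) ↔ i < j := by
  refine ⟨fun h => ?_, he i j⟩
  by_contra! hji
  rcases hji.lt_or_eq with hlt | rfl
  · exact hξ.1 _ (hξ.2.1 _ _ _ h (he _ _ hlt))
  · exact hξ.1 _ h

/-- The rank of an element is determined by its lower section. -/
lemma rank_eq_of_lower_eq (hξ : StrictTotal ξ) (he : ∀ i j, i < j → ξ (e i) (e j))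
    (hξ' : StrictTotal ξ') (he' : ∀ i j, i < j → ξ' (e' i) (e' j)) {k k' : Fin n}
    (hlow : ∀ z, (ξ' z (e' k') ∨ z = e' k') ↔ (ξ z (e k) ∨ z = e k)) : k' = k := by
  have hmap : (Finset.Iic k').map e'.toEmbedding = (Finset.Iic k).map e.toEmbedding := by
    ext z
    have hz := hlow z
    obtain ⟨i, rfl⟩ := e.surjective z
    obtain ⟨i', hi'⟩ := e'.surjective (e i)
    rw [hξ.rel_iff_lt he, e.apply_eq_iff_eq, ← le_iff_lt_or_eq, ← hi', hξ'.rel_iff_lt he',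
      e'.apply_eq_iff_eq, ← le_iff_lt_or_eq] at hz
    have h1 : e.symm (e' i') = i := by rw [hi', e.symm_apply_apply]
    rw [← hi']
    simpa [Finset.mem_map_equiv, h1] using hz
  have hcard := congrArg Finset.card hmap
  simp only [Finset.card_map, Fin.card_Iic] at hcard
  exact Fin.ext (by omega)

lemma mpiAux_rank_le (hξ : StrictTotal ξ) (hξ' : StrictTotal ξ') (hadm' : Adm v ξ')
    (he : ∀ i j, i < j → ξ (e i) (e j)) (he' : ∀ i j, i < j → ξ' (e' i) (e' j)) (i j : Fin n) :
    mpiAux v ξ (e i) (e j) ≤ mpiAux v ξ' (e' i) (e' j) := by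
  have : Finite B := Finite.of_equiv _ e
  refine mpiAux_le_mpiAux hξ hξ' hadm' fun p p' hlow hxp hpy => ?_
  obtain ⟨k, rfl⟩ := e.surjective p
  obtain ⟨k', rfl⟩ := e'.surjective p'
  obtain rfl := rank_eq_of_lower_eq hξ he hξ' he' hlow
  simpa only [hξ.rel_iff_lt he, hξ'.rel_iff_lt he', EmbeddingLike.apply_eq_iff_eq]
    using And.intro hxp hpy

lemma mpi_rank_eq (hξ : StrictTotal ξ) (hadm : Adm v ξ) (hξ' : StrictTotal ξ')
    (hadm' : Adm v ξ') (he : ∀ i j, i < j → ξ (e i) (e j))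
    (he' : ∀ i j, i < j → ξ' (e' i) (e' j)) (i j : Fin n) :
    mpi v ξ (e i) (e j) = mpi v ξ' (e' i) (e' j) := by
  have heq (i j : Fin n) : mpiAux v ξ (e i) (e j) = mpiAux v ξ' (e' i) (e' j) :=
    le_antisymm (mpiAux_rank_le hξ hξ' hadm' he he' i j) (mpiAux_rank_le hξ' hξ hadm he' he i j)
  simp only [mpi, hξ.rel_iff_lt he, hξ'.rel_iff_lt he', heq]

end

/-- The projected scores are independent of the admissible order
used: for two admissible orders `ξ`, `ξ'`, (i) `v^π_{xy}` is the same, and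
(ii) the matrix entries by rank coincide: if `e`, `e'` enumerate `A` in the
orders `ξ`, `ξ'` respectively, then `v^π_{e i, e j} = v^π_{e' i, e' j}`. -/
theorem stmt5 {A : Type*} [Fintype A] [DecidableEq A] (v : A → A → ℝ)
    (hv : Llull v) (ξ ξ' : A → A → Prop)
    (hξ : StrictTotal ξ) (hadm : Adm v ξ)
    (hξ' : StrictTotal ξ') (hadm' : Adm v ξ') :
    (∀ x y : A, x ≠ y → vpi v ξ x y = vpi v ξ' x y) ∧
    (∀ e e' : Fin (Fintype.card A) ≃ A,
      (∀ i j, i < j → ξ (e i) (e j)) → (∀ i j, i < j → ξ' (e' i) (e' j)) →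
      ∀ i j : Fin (Fintype.card A), i ≠ j →
        vpi v ξ (e i) (e j) = vpi v ξ' (e' i) (e' j)) := by
  refine ⟨fun x y hxy => ?_, fun e e' he he' i j _ => ?_⟩
  · rw [vpi, vpi, mpi_eq_mpi hξ hadm hξ' hadm' hxy]
  · rw [vpi, vpi, mpi_rank_eq hξ hadm hξ' hadm' he he' i j]
end

section
/- Let v be a complete Llull matrix on a finite set A with margins m_{xy} = v_{xy} − v_{yx}. Assume there exists a strict total order ξ on A such that m_{xy} ≥ 0 whenever x precedes y in ξ, and m_{xz} = max(m_{xy}, m_{yz}) whenever x precedes y and y precedes z in ξ. Then the projected scores coincide with the original ones: v^π_{xy} = v_{xy} for every ordered pair (x,y) of distinct elements. -/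
/-! Common definitions: valued relations, indirect scores, admissible orders,
projected margins/scores, rank-like rates (Camps–Mora–Saumell CLC method). -/

variable {A : Type*} [Fintype A] [DecidableEq A]

/-- The score of a path with distinct endpoints is at most the score of the pair of
endpoints, provided that `v` is max-min transitive on triples of distinct elements. -/
lemma linkScore_le_of_maxmin {B : Type*} {v : B → B → ℝ}
    (ht : ∀ x y z, x ≠ y → y ≠ z → x ≠ z → min (v x y) (v y z) ≤ v x z) (y : B) (l : List B) :
    ∀ x, x ≠ y → List.IsChain (· ≠ ·) (x :: (l ++ [y])) →
      linkScore v (x :: (l ++ [y])) ≤ v x y := by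
  induction l with
  | nil => intro x _ _; exact le_rfl
  | cons a l ih =>
    intro x hxy hc
    have hs : linkScore v (x :: (a :: l ++ [y])) =
        min (v x a) (linkScore v (a :: (l ++ [y]))) := by
      cases l <;> rfl
    rw [hs]
    rw [List.cons_append, List.isChain_cons_cons] at hc
    obtain rfl | hay := eq_or_ne a y
    · exact min_le_left _ _
    · exact (min_le_min_left _ (ih a hay hc.2)).trans (ht x a y hc.1 hay hxy)

lemma istar_eq_of_maxmin {B : Type*} {v : B → B → ℝ}
    (ht : ∀ x y z, x ≠ y → y ≠ z → x ≠ z → min (v x y) (v y z) ≤ v x z) {x y : B}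
    (hxy : x ≠ y) : istar v x y = v x y := by
  refine IsGreatest.csSup_eq ⟨⟨[], List.isChain_pair.2 hxy, rfl⟩, ?_⟩
  rintro s ⟨l, hc, rfl⟩
  exact linkScore_le_of_maxmin ht y l x hxy hc

/-- A function on pairs that is max-additive along a strict total order attains its value
at some pair of consecutive elements of the interval. -/
lemma exists_immSucc_eq {B : Type*} [Finite B] {η : B → B → Prop} (hη : StrictTotal η)
    {M : B → B → ℝ} (h2 : ∀ x y z, η x y → η y z → M x z = max (M x y) (M y z))
    {x y : B} (hxy : η x y) :
    ∃ p q, (η x p ∨ p = x) ∧ η p y ∧ ImmSucc η p q ∧ M p q = M x y := by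
  obtain ⟨hi, htr, -⟩ := hη
  induction hn : {z | η x z ∧ η z y}.ncard using Nat.strong_induction_on generalizing x y with
  | _ n ih =>
    subst hn
    by_cases hz : ∃ z, η x z ∧ η z y
    · obtain ⟨z, hxz, hzy⟩ := hz
      rcases max_choice (M x z) (M z y) with h | h
      · obtain ⟨p, q, hp, hpz, hs, he⟩ := ih _ (Set.ncard_lt_ncard (t := {w | η x w ∧ η w y})
          ⟨fun w hw => ⟨hw.1, htr _ _ _ hw.2 hzy⟩, fun hsub => hi z (hsub ⟨hxz, hzy⟩).2⟩
          (Set.toFinite _)) hxz rfl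
        exact ⟨p, q, hp, htr _ _ _ hpz hzy, hs, by rw [he, h2 x z y hxz hzy, h]⟩
      · obtain ⟨p, q, hp, hpy, hs, he⟩ := ih _ (Set.ncard_lt_ncard (t := {w | η x w ∧ η w y})
          ⟨fun w hw => ⟨htr _ _ _ hxz hw.1, hw.2⟩, fun hsub => hi z (hsub ⟨hxz, hzy⟩).1⟩
          (Set.toFinite _)) hzy rfl
        refine ⟨p, q, Or.inl ?_, hpy, hs, by rw [he, h2 x z y hxz hzy, h]⟩
        rcases hp with hp | rfl
        · exact htr _ _ _ hxz hp
        · exact hxz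
    · push Not at hz
      exact ⟨x, y, Or.inr rfl, hxy, ⟨hxy, fun z h => hz z h.1 h.2⟩, rfl⟩

/-- Max-additivity of the margins transfers to every total order along which they are
nonnegative. -/
lemma margin_max_of_nonneg {B : Type*} {v : B → B → ℝ} {ξ η : B → B → Prop}
    (hξ : StrictTotal ξ) (hη : StrictTotal η)
    (h1 : ∀ x y, ξ x y → 0 ≤ v x y - v y x)
    (h2 : ∀ x y z, ξ x y → ξ y z →
      v x z - v z x = max (v x y - v y x) (v y z - v z y))
    (h1' : ∀ x y, η x y → 0 ≤ v x y - v y x) {x y z : B} (hxy : η x y) (hyz : η y z) :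
    v x z - v z x = max (v x y - v y x) (v y z - v z y) := by
  have hxz := hη.2.1 x y z hxy hyz
  have ne : ∀ {a b}, η a b → a ≠ b := by
    rintro a _ h rfl
    exact hη.1 a h
  have a1 := h1' x y hxy
  have a2 := h1' y z hyz
  have a3 := h1' x z hxz
  rcases hξ.2.2 x y (ne hxy) with h | h <;> rcases hξ.2.2 y z (ne hyz) with h' | h' <;>
    rcases hξ.2.2 x z (ne hxz) with h'' | h'' <;>
    have b1 := h1 _ _ h <;> have b2 := h1 _ _ h' <;> have b3 := h1 _ _ h'' <;>
    grind

/-- Margins that are nonnegative and max-additive along a total order give a max-min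
transitive matrix. -/
lemma Llull.maxmin_of_margin_max {B : Type*} {v : B → B → ℝ} (hv : Llull v)
    {ξ : B → B → Prop} (hξ : StrictTotal ξ) (h1 : ∀ x y, ξ x y → 0 ≤ v x y - v y x)
    (h2 : ∀ x y z, ξ x y → ξ y z →
      v x z - v z x = max (v x y - v y x) (v y z - v z y))
    (x y z : B) (hxy : x ≠ y) (hyz : y ≠ z) (hxz : x ≠ z) :
    min (v x y) (v y z) ≤ v x z := by
  have a1 := (hv x y hxy).2.2
  have a2 := (hv y z hyz).2.2
  have a3 := (hv x z hxz).2.2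
  rcases hξ.2.2 x y hxy with h | h <;> rcases hξ.2.2 y z hyz with h' | h' <;>
    rcases hξ.2.2 x z hxz with h'' | h'' <;>
    have b1 := h1 _ _ h <;> have b2 := h1 _ _ h' <;> have b3 := h1 _ _ h'' <;>
    grind

lemma mpiAux_eq_margin {B : Type*} [Finite B] {v : B → B → ℝ} {η : B → B → Prop}
    (hη : StrictTotal η) (hstar : ∀ x y, x ≠ y → istar v x y = v x y)
    (h2 : ∀ x y z, η x y → η y z →
      v x z - v z x = max (v x y - v y x) (v y z - v z y)) {x y : B} (hxy : η x y) :
    mpiAux v η x y = v x y - v y x := by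
  have hmono : ∀ p x y q, (η p x ∨ p = x) → η x y → (η y q ∨ q = y) →
      η p q ∧ v x y - v y x ≤ v p q - v q p := by
    intro p x y q hp hxy hq
    have hpy : η p y ∧ v x y - v y x ≤ v p y - v y p := by
      rcases hp with hp | rfl
      · exact ⟨hη.2.1 _ _ _ hp hxy, by rw [h2 p x y hp hxy]; exact le_max_right _ _⟩
      · exact ⟨hxy, le_rfl⟩
    rcases hq with hq | rfl
    · exact ⟨hη.2.1 _ _ _ hpy.1 hq, by
        rw [h2 p y q hpy.1 hq]; exact hpy.2.trans (le_max_left _ _)⟩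
    · exact hpy
  have hne : ∀ {a b}, η a b → a ≠ b := by
    rintro a _ h rfl
    exact hη.1 a h
  have hsigma : ∀ p q, η p q → msigma v η p q = v p q - v q p := by
    intro p q hpq
    refine IsLeast.csInf_eq ⟨⟨p, q, Or.inr rfl, Or.inr rfl, ?_⟩, ?_⟩
    · rw [hstar _ _ (hne hpq), hstar _ _ (hne hpq).symm]
    · rintro s ⟨p', q', hp, hq, rfl⟩
      obtain ⟨h, hle⟩ := hmono p' p q q' hp hpq hq
      rwa [hstar _ _ (hne h), hstar _ _ (hne h).symm]
  refine IsGreatest.csSup_eq ⟨?_, ?_⟩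
  · obtain ⟨p, q, hp, hpy, hs, he⟩ :=
      exists_immSucc_eq hη (M := fun x y => v x y - v y x) h2 hxy
    exact ⟨p, q, hp, hpy, hs, by rw [hsigma p q hs.1]; exact he.symm⟩
  · rintro s ⟨p, q, hp, hpy, hs, rfl⟩
    rw [hsigma p q hs.1]
    refine (hmono x p q y (hp.imp_right Eq.symm) hs.1 ?_).2
    by_cases hqy : y = q
    · exact Or.inr hqy
    · exact Or.inl ((hη.2.2 y q hqy).resolve_left fun h => hs.2 y ⟨hpy, h⟩)

/-- If there is a strict total order `ξ` such that the margins
`m_{xy} = v_{xy} - v_{yx}` satisfy `m_{xy} ≥ 0` whenever `x ≺ y` and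
`m_{xz} = max (m_{xy}, m_{yz})` whenever `x ≺ y ≺ z`, then the projected scores
(computed with respect to any admissible order) coincide with the original
scores. -/
theorem stmt7 {A : Type*} [Fintype A] [DecidableEq A] (v : A → A → ℝ)
    (hv : Llull v) (ξ : A → A → Prop) (hξ : StrictTotal ξ)
    (h1 : ∀ x y, ξ x y → 0 ≤ v x y - v y x)
    (h2 : ∀ x y z, ξ x y → ξ y z →
      v x z - v z x = max (v x y - v y x) (v y z - v z y)) :
    ∀ η : A → A → Prop, StrictTotal η → Adm v η →
      ∀ x y : A, x ≠ y → vpi v η x y = v x y := by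
  intro η hη hadm x y hxy
  have hstar : ∀ x y, x ≠ y → istar v x y = v x y := fun x y =>
    istar_eq_of_maxmin (hv.maxmin_of_margin_max hξ h1 h2)
  have h1' : ∀ x y, η x y → 0 ≤ v x y - v y x := by
    intro x y h
    by_contra! hlt
    have hne : x ≠ y := by
      rintro rfl
      exact hη.1 x h
    refine hη.1 x (hη.2.1 _ _ _ h (hadm y x ?_))
    rw [hstar x y hne, hstar y x hne.symm]
    linarith
  have h2' : ∀ x y z, η x y → η y z →
      v x z - v z x = max (v x y - v y x) (v y z - v z y) := fun x y z =>
    margin_max_of_nonneg hξ hη h1 h2 h1'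
  have hs := (hv x y hxy).2.2
  unfold vpi mpi
  split_ifs with h
  · rw [mpiAux_eq_margin hη hstar h2' h]
    linarith
  · rw [mpiAux_eq_margin hη hstar h2' ((hη.2.2 x y hxy).resolve_left h)]
    linarith
end
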